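/- arXiv:1408.1231 — 2 statements merged into one kernel-verified Lean document; each statement's English description precedes it below -/
import Mathlib

section
/- Every AF inverse monoid is a fundamental Boolean inverse ∧-monoid that is completely semisimple, factorizable, and in which D preserves complementation; that is, every AF inverse monoid is a fundamental Foulis ∧-monoid. -/
namespace Coordinatization

/-- The data of a monoid with zero equipped with an inverse operation. -/
structure InvMonData (S : Type) where
  mul : S → S → S
  one : S
  zero : S
  inv : S → S

variable {S T : Type}

/-- `M` is an inverse monoid with zero: a monoid with zero in which every element `a`
has a unique generalized inverse `a⁻¹`. -/
structure IsInverseMonoid (M : InvMonData S) : Prop where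
  mul_assoc : ∀ a b c, M.mul (M.mul a b) c = M.mul a (M.mul b c)
  one_mul : ∀ a, M.mul M.one a = a
  mul_one : ∀ a, M.mul a M.one = a
  zero_mul : ∀ a, M.mul M.zero a = M.zero
  mul_zero : ∀ a, M.mul a M.zero = M.zero
  inv_law₁ : ∀ a, M.mul (M.mul a (M.inv a)) a = a
  inv_law₂ : ∀ a, M.mul (M.mul (M.inv a) a) (M.inv a) = M.inv a
  inv_unique : ∀ a b, M.mul (M.mul a b) a = a → M.mul (M.mul b a) b = b → b = M.inv a

/-- `e` is an idempotent. -/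
def IsIdem (M : InvMonData S) (e : S) : Prop := M.mul e e = e

/-- The natural partial order: `a ≤ b` iff `a = b·e` for some idempotent `e`. -/
def nle (M : InvMonData S) (a b : S) : Prop := ∃ e, IsIdem M e ∧ a = M.mul b e

/-- `a` and `b` are compatible: `a⁻¹b` and `ab⁻¹` are both idempotents. -/
def Compatible (M : InvMonData S) (a b : S) : Prop :=
  IsIdem M (M.mul (M.inv a) b) ∧ IsIdem M (M.mul a (M.inv b))

/-- `a` and `b` are orthogonal: `a⁻¹b = 0 = ab⁻¹`. -/
def Orthogonal (M : InvMonData S) (a b : S) : Prop :=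
  M.mul (M.inv a) b = M.zero ∧ M.mul a (M.inv b) = M.zero

/-- `j` is the join of `a` and `b` with respect to the natural partial order. -/
def IsJoin (M : InvMonData S) (a b j : S) : Prop :=
  nle M a j ∧ nle M b j ∧ ∀ c, nle M a c → nle M b c → nle M j c

/-- `m` is the meet of `a` and `b` with respect to the natural partial order. -/
def IsMeet (M : InvMonData S) (a b m : S) : Prop :=
  nle M m a ∧ nle M m b ∧ ∀ c, nle M c a → nle M c b → nle M c m

/-- Green's relation `D`: `e D f` iff there is `a` with `a⁻¹a = e` and `aa⁻¹ = f`. -/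
def DRel (M : InvMonData S) (e f : S) : Prop :=
  ∃ a, M.mul (M.inv a) a = e ∧ M.mul a (M.inv a) = f

/-- `f` is a Boolean complement of the idempotent `e` in the Boolean algebra of
idempotents: `e·f = 0` and `e ∨ f = 1`. -/
def IsComplPair (M : InvMonData S) (e f : S) : Prop :=
  IsIdem M e ∧ IsIdem M f ∧ M.mul e f = M.zero ∧ IsJoin M e f M.one

/-- A Boolean inverse monoid: an inverse monoid with zero in which the idempotents form a
Boolean algebra under the natural partial order (meets of idempotents are given by products;
complements exist), all compatible binary joins exist, and multiplication distributes over
binary joins. -/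
structure IsBooleanInverseMonoid (M : InvMonData S) : Prop where
  invMon : IsInverseMonoid M
  joins_exist : ∀ a b, Compatible M a b → ∃ j, IsJoin M a b j
  mul_join_left : ∀ c a b j, IsJoin M a b j → IsJoin M (M.mul c a) (M.mul c b) (M.mul c j)
  mul_join_right : ∀ c a b j, IsJoin M a b j → IsJoin M (M.mul a c) (M.mul b c) (M.mul j c)
  compl_exists : ∀ e, IsIdem M e → ∃ f, IsComplPair M e f

/-- The relation `D` preserves complementation: `e D f` implies `ē D f̄`. -/
def DPreservesCompl (M : InvMonData S) : Prop :=
  ∀ e f e' f', DRel M e f → IsComplPair M e e' → IsComplPair M f f' → DRel M e' f'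

/-- `M` is completely semisimple: `e D f ≤ e` implies `e = f` for idempotents. -/
def CompletelySemisimple (M : InvMonData S) : Prop :=
  ∀ e f, IsIdem M e → IsIdem M f → DRel M e f → nle M f e → e = f

/-- A Foulis monoid: a completely semisimple Boolean inverse monoid in which `D`
preserves complementation. -/
def IsFoulis (M : InvMonData S) : Prop :=
  IsBooleanInverseMonoid M ∧ CompletelySemisimple M ∧ DPreservesCompl M

/-- The preorder underlying `S/J`: `Jle s t` iff `SsS ⊆ StS`, i.e. `s = a·t·b` for some `a, b`. -/
def Jle (M : InvMonData S) (s t : S) : Prop := ∃ a b, s = M.mul (M.mul a t) b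

/-- `S/J`, the poset of principal ideals, is a lattice. -/
def LatticeCondition (M : InvMonData S) : Prop :=
  ∀ s t : S,
    (∃ m, Jle M m s ∧ Jle M m t ∧ ∀ c, Jle M c s → Jle M c t → Jle M c m) ∧
    (∃ j, Jle M s j ∧ Jle M t j ∧ ∀ c, Jle M s c → Jle M t c → Jle M j c)

/-- `[e] ⊕ [f] = [g]` in `E(S)/D`: there are orthogonal idempotents `e' D e` and `f' D f`
whose join is `D`-related to `g`. -/
def OplusEq (M : InvMonData S) (e f g : S) : Prop :=
  ∃ e' f' j, IsIdem M e' ∧ IsIdem M f' ∧ DRel M e e' ∧ DRel M f f' ∧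
    M.mul e' f' = M.zero ∧ IsJoin M e' f' j ∧ DRel M j g

/-- `M` is fundamental: only idempotents commute with every idempotent. -/
def Fundamental (M : InvMonData S) : Prop :=
  ∀ s, (∀ e, IsIdem M e → M.mul s e = M.mul e s) → IsIdem M s

/-- `M` is factorizable: every element lies beneath a unit. -/
def Factorizable (M : InvMonData S) : Prop :=
  ∀ s, ∃ g, M.mul g (M.inv g) = M.one ∧ M.mul (M.inv g) g = M.one ∧ nle M s g

/-- All binary meets exist (`∧`-monoid). -/
def HasMeets (M : InvMonData S) : Prop := ∀ a b, ∃ m, IsMeet M a b m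

/-- A morphism of Boolean inverse `∧`-monoids: a monoid homomorphism mapping zero to zero,
preserving binary compatible joins and binary meets. -/
def IsMorphism (M : InvMonData S) (N : InvMonData T) (f : S → T) : Prop :=
  f M.one = N.one ∧ f M.zero = N.zero ∧
  (∀ a b, f (M.mul a b) = N.mul (f a) (f b)) ∧
  (∀ a b j, Compatible M a b → IsJoin M a b j → IsJoin N (f a) (f b) (f j)) ∧
  (∀ a b m, IsMeet M a b m → IsMeet N (f a) (f b) (f m))

end Coordinatization
namespace Coordinatization

/-- The symmetric inverse monoid `Iₙ` of all partial bijections of `Fin n`,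
with composition as multiplication, the identity as `1`, the empty map as `0`,
and the inverse partial bijection as inversion. -/
def symData (n : ℕ) : InvMonData (PEquiv (Fin n) (Fin n)) where
  mul f g := g.trans f
  one := PEquiv.refl (Fin n)
  zero := ⊥
  inv f := f.symm

/-- Direct products of inverse monoids, with componentwise operations. -/
def piData {ι : Type} {β : ι → Type} (Ms : ∀ i, InvMonData (β i)) :
    InvMonData (∀ i, β i) where
  mul f g i := (Ms i).mul (f i) (g i)
  one i := (Ms i).one
  zero i := (Ms i).zero
  inv f i := (Ms i).inv (f i)

/-- A semisimple inverse monoid: the finite direct product `I_{m 0} × ⋯ × I_{m (k-1)}`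
of finite symmetric inverse monoids. -/
def ssData (k : ℕ) (m : Fin k → ℕ) :
    InvMonData (∀ i : Fin k, PEquiv (Fin (m i)) (Fin (m i))) :=
  piData (fun i => symData (m i))

/-- The partial identity `1_A` on a subset `A` of `Fin n`. -/
def pid {n : ℕ} (A : Finset (Fin n)) : PEquiv (Fin n) (Fin n) where
  toFun x := if x ∈ A then some x else none
  invFun x := if x ∈ A then some x else none
  inv a b := by
    by_cases ha : a ∈ A <;> by_cases hb : b ∈ A <;>
      simp_all [Option.mem_def, eq_comm] <;> aesop

end Coordinatization
namespace Coordinatization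

/-- The semisimple inverse monoid at level `i` of a sequence of semisimple inverse
monoids: the direct product of the symmetric inverse monoids `I_{m i j}`, `j < k i`. -/
abbrev Level (k : ℕ → ℕ) (m : ∀ i, Fin (k i) → ℕ) (i : ℕ) : Type :=
  ∀ j : Fin (k i), PEquiv (Fin (m i j)) (Fin (m i j))

/-- `M` is an AF inverse monoid: it is the direct limit of a sequence
`S₀ → S₁ → S₂ → ⋯` of semisimple inverse monoids and injective morphisms of Boolean
inverse `∧`-monoids.  This is expressed by a compatible family of injective morphisms
`φᵢ : Sᵢ → M` (which also respect inversion) whose images exhaust `M`. -/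
def IsAF {T : Type} (M : InvMonData T) : Prop :=
  ∃ (k : ℕ → ℕ) (m : ∀ i, Fin (k i) → ℕ)
    (τ : ∀ i, Level k m i → Level k m (i + 1))
    (φ : ∀ i, Level k m i → T),
    (∀ i, IsMorphism (ssData (k i) (m i)) (ssData (k (i + 1)) (m (i + 1))) (τ i)) ∧
    (∀ i, Function.Injective (τ i)) ∧
    (∀ i, IsMorphism (ssData (k i) (m i)) M (φ i)) ∧
    (∀ i, Function.Injective (φ i)) ∧
    (∀ i a, φ i ((ssData (k i) (m i)).inv a) = M.inv (φ i a)) ∧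
    (∀ i a, φ (i + 1) (τ i a) = φ i a) ∧
    (∀ t : T, ∃ i a, φ i a = t)

section SemisimpleLevel

variable {k : ℕ} {m : Fin k → ℕ}

open Classical in
/-- The partial bijection whose graph is a given functional and injective relation. -/
noncomputable def pequivOfRel {α β : Type} (R : α → β → Prop)
    (hfun : ∀ x y y', R x y → R x y' → y = y') (hinj : ∀ x x' y, R x y → R x' y → x = x') :
    PEquiv α β where
  toFun x := if h : ∃ y, R x y then some h.choose else none
  invFun y := if h : ∃ x, R x y then some h.choose else none
  inv a b := by
    constructor
    · intro h
      split_ifs at h with hb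
      · obtain rfl := Option.some.inj h
        have ha : ∃ y, R hb.choose y := ⟨b, hb.choose_spec⟩
        rw [dif_pos ha]
        exact congrArg some (hfun _ _ _ ha.choose_spec hb.choose_spec)
    · intro h
      split_ifs at h with ha
      · obtain rfl := Option.some.inj h
        have hb : ∃ x, R x ha.choose := ⟨a, ha.choose_spec⟩
        rw [dif_pos hb]
        exact congrArg some (hinj _ _ _ hb.choose_spec ha.choose_spec)

theorem mem_pequivOfRel {α β : Type} {R : α → β → Prop}
    {hfun : ∀ x y y', R x y → R x y' → y = y'} {hinj : ∀ x x' y, R x y → R x' y → x = x'}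
    {x : α} {y : β} : y ∈ pequivOfRel R hfun hinj x ↔ R x y := by
  classical
  change y ∈ (if h : ∃ y, R x y then some h.choose else none) ↔ _
  split_ifs with h
  · constructor
    · intro hy
      obtain rfl := Option.some.inj hy
      exact h.choose_spec
    · intro hy
      exact congrArg some (hfun _ _ _ h.choose_spec hy)
  · simp only [Option.mem_def, reduceCtorEq, false_iff]
    exact fun hy => h ⟨y, hy⟩

theorem ss_ext {a b : ∀ i : Fin k, PEquiv (Fin (m i)) (Fin (m i))}
    (h : ∀ i x y, y ∈ a i x ↔ y ∈ b i x) : a = b :=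
  funext fun i => PEquiv.ext fun x => Option.ext fun y => h i x y

theorem mem_ss_mul {a b : ∀ i : Fin k, PEquiv (Fin (m i)) (Fin (m i))} {i x z} :
    z ∈ (ssData k m).mul a b i x ↔ ∃ y, y ∈ b i x ∧ z ∈ a i y :=
  PEquiv.mem_trans _ _ _ _

theorem mem_ss_inv {a : ∀ i : Fin k, PEquiv (Fin (m i)) (Fin (m i))} {i x y} :
    y ∈ (ssData k m).inv a i x ↔ x ∈ a i y :=
  PEquiv.mem_iff_mem _

theorem mem_ss_one {i x y} : y ∈ (ssData k m).one i x ↔ x = y := by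
  change y ∈ some x ↔ _
  simp

theorem not_mem_ss_zero {i x y} : ¬ y ∈ (ssData k m).zero i x := by
  change ¬ y ∈ none
  simp

theorem ss_functional (a : ∀ i : Fin k, PEquiv (Fin (m i)) (Fin (m i))) {i x y y'}
    (h : y ∈ a i x) (h' : y' ∈ a i x) : y = y' :=
  Option.mem_unique h h'

theorem ss_injective (a : ∀ i : Fin k, PEquiv (Fin (m i)) (Fin (m i))) {i x x' y}
    (h : y ∈ a i x) (h' : y ∈ a i x') : x = x' :=
  PEquiv.inj _ h h'

theorem ss_isIdem_iff {e : ∀ i : Fin k, PEquiv (Fin (m i)) (Fin (m i))} :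
    IsIdem (ssData k m) e ↔ ∀ i x y, y ∈ e i x → x = y := by
  constructor
  · intro h i x y hy
    have hy' := hy
    rw [← show (ssData k m).mul e e = e from h, mem_ss_mul] at hy'
    obtain ⟨z, hz, hyz⟩ := hy'
    obtain rfl := ss_functional e hz hy
    exact ss_injective e hz hyz
  · intro h
    refine ss_ext fun i x y => mem_ss_mul.trans ⟨?_, fun hy => ?_⟩
    · rintro ⟨z, hz, hy⟩
      obtain rfl := h _ _ _ hz
      exact hy
    · obtain rfl := h _ _ _ hy
      exact ⟨x, hy, hy⟩

/-- The idempotent of the semisimple inverse monoid supported on a predicate. -/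
noncomputable def ssIdem (P : ∀ i : Fin k, Fin (m i) → Prop) :
    ∀ i : Fin k, PEquiv (Fin (m i)) (Fin (m i)) :=
  fun i => pequivOfRel (fun x y => x = y ∧ P i x)
    (by rintro x y y' ⟨rfl, -⟩ ⟨rfl, -⟩; rfl) (by rintro x x' y ⟨rfl, -⟩ ⟨rfl, -⟩; rfl)

theorem mem_ssIdem {P : ∀ i : Fin k, Fin (m i) → Prop} {i x y} :
    y ∈ ssIdem P i x ↔ x = y ∧ P i x :=
  mem_pequivOfRel

theorem ssIdem_isIdem (P : ∀ i : Fin k, Fin (m i) → Prop) : IsIdem (ssData k m) (ssIdem P) :=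
  ss_isIdem_iff.2 fun _ _ _ h => (mem_ssIdem.1 h).1

theorem mem_ss_inv_mul_self {a : ∀ i : Fin k, PEquiv (Fin (m i)) (Fin (m i))} {i x y} :
    y ∈ (ssData k m).mul ((ssData k m).inv a) a i x ↔ x = y ∧ ∃ z, z ∈ a i x := by
  simp only [mem_ss_mul, mem_ss_inv]
  constructor
  · rintro ⟨z, hz, hz'⟩
    exact ⟨ss_injective a hz hz', z, hz⟩
  · rintro ⟨rfl, z, hz⟩
    exact ⟨z, hz, hz⟩

theorem mem_ss_mul_inv_self {a : ∀ i : Fin k, PEquiv (Fin (m i)) (Fin (m i))} {i x y} :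
    y ∈ (ssData k m).mul a ((ssData k m).inv a) i x ↔ x = y ∧ ∃ z, x ∈ a i z := by
  simp only [mem_ss_mul, mem_ss_inv]
  constructor
  · rintro ⟨z, hz, hz'⟩
    exact ⟨ss_functional a hz hz', z, hz⟩
  · rintro ⟨rfl, z, hz⟩
    exact ⟨z, hz, hz⟩

theorem ss_nle_iff {a b : ∀ i : Fin k, PEquiv (Fin (m i)) (Fin (m i))} :
    nle (ssData k m) a b ↔ ∀ i x y, y ∈ a i x → y ∈ b i x := by
  constructor
  · rintro ⟨e, he, rfl⟩ i x y hy
    obtain ⟨z, hz, hy⟩ := mem_ss_mul.1 hy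
    obtain rfl := ss_isIdem_iff.1 he _ _ _ hz
    exact hy
  · intro h
    refine ⟨ssIdem fun i x => ∃ y, y ∈ a i x, ssIdem_isIdem _, ss_ext fun i x y => ?_⟩
    simp only [mem_ss_mul, mem_ssIdem]
    constructor
    · exact fun hy => ⟨x, ⟨rfl, y, hy⟩, h _ _ _ hy⟩
    · rintro ⟨z, ⟨rfl, w, hw⟩, hy⟩
      obtain rfl := ss_functional b (h _ _ _ hw) hy
      exact hw

theorem ss_nle_iff_eq {a b : ∀ i : Fin k, PEquiv (Fin (m i)) (Fin (m i))} :
    nle (ssData k m) a b ↔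
      a = (ssData k m).mul b ((ssData k m).mul ((ssData k m).inv a) a) := by
  constructor
  · intro h
    rw [ss_nle_iff] at h
    refine ss_ext fun i x y => ?_
    rw [mem_ss_mul]
    simp only [mem_ss_inv_mul_self]
    constructor
    · exact fun hy => ⟨x, ⟨rfl, y, hy⟩, h _ _ _ hy⟩
    · rintro ⟨z, ⟨rfl, w, hw⟩, hy⟩
      obtain rfl := ss_functional b (h _ _ _ hw) hy
      exact hw
  · exact fun h => ⟨_, ss_isIdem_iff.2 fun _ _ _ hy => (mem_ss_inv_mul_self.1 hy).1, h⟩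

theorem ss_compatible_iff {a b : ∀ i : Fin k, PEquiv (Fin (m i)) (Fin (m i))} :
    Compatible (ssData k m) a b ↔
      (∀ i x x' y, y ∈ a i x → y ∈ b i x' → x = x') ∧
        ∀ i x y y', y ∈ a i x → y' ∈ b i x → y = y' := by
  simp only [Compatible, ss_isIdem_iff, mem_ss_mul, mem_ss_inv]
  constructor
  · rintro ⟨h₁, h₂⟩
    exact ⟨fun i x x' y hx hx' => (h₁ i x' x ⟨y, hx', hx⟩).symm,
      fun i x y y' hy hy' => (h₂ i y' y ⟨x, hy', hy⟩).symm⟩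
  · rintro ⟨h₁, h₂⟩
    constructor
    · rintro i x y ⟨z, hz, hz'⟩
      exact (h₁ _ _ _ _ hz' hz).symm
    · rintro i x y ⟨z, hz, hz'⟩
      exact (h₂ _ _ _ _ hz' hz).symm

theorem ss_compatible_of_nle {a b j : ∀ i : Fin k, PEquiv (Fin (m i)) (Fin (m i))}
    (ha : nle (ssData k m) a j) (hb : nle (ssData k m) b j) : Compatible (ssData k m) a b := by
  rw [ss_nle_iff] at ha hb
  exact ss_compatible_iff.2
    ⟨fun _ _ _ _ h h' => ss_injective j (ha _ _ _ h) (hb _ _ _ h'),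
      fun _ _ _ _ h h' => ss_functional j (ha _ _ _ h) (hb _ _ _ h')⟩

theorem ss_isJoin_of_mem {a b j : ∀ i : Fin k, PEquiv (Fin (m i)) (Fin (m i))}
    (h : ∀ i x y, y ∈ j i x ↔ y ∈ a i x ∨ y ∈ b i x) : IsJoin (ssData k m) a b j := by
  simp only [IsJoin, ss_nle_iff, h]
  grind

theorem ss_exists_join {a b : ∀ i : Fin k, PEquiv (Fin (m i)) (Fin (m i))}
    (h : Compatible (ssData k m) a b) : ∃ j : ∀ i : Fin k, PEquiv (Fin (m i)) (Fin (m i)),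
      ∀ i x y, y ∈ j i x ↔ y ∈ a i x ∨ y ∈ b i x := by
  obtain ⟨h₁, h₂⟩ := ss_compatible_iff.1 h
  refine ⟨fun i => pequivOfRel (fun x y => y ∈ a i x ∨ y ∈ b i x) ?_ ?_,
    fun i x y => mem_pequivOfRel⟩
  · rintro x y y' (hy | hy) (hy' | hy')
    · exact ss_functional a hy hy'
    · exact h₂ _ _ _ _ hy hy'
    · exact (h₂ _ _ _ _ hy' hy).symm
    · exact ss_functional b hy hy'
  · rintro x x' y (hy | hy) (hy' | hy')
    · exact ss_injective a hy hy'
    · exact h₁ _ _ _ _ hy hy'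
    · exact (h₁ _ _ _ _ hy' hy).symm
    · exact ss_injective b hy hy'

theorem ss_isJoin_iff {a b j : ∀ i : Fin k, PEquiv (Fin (m i)) (Fin (m i))} :
    IsJoin (ssData k m) a b j ↔ ∀ i x y, y ∈ j i x ↔ y ∈ a i x ∨ y ∈ b i x := by
  refine ⟨fun h => ?_, ss_isJoin_of_mem⟩
  obtain ⟨u, hu⟩ := ss_exists_join (ss_compatible_of_nle h.1 h.2.1)
  have hub := ss_isJoin_of_mem hu
  have hju := ss_nle_iff.1 (h.2.2 u hub.1 hub.2.1)
  have huj := ss_nle_iff.1 (hub.2.2 j h.1 h.2.1)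
  exact fun i x y => ⟨fun hy => (hu i x y).1 (hju _ _ _ hy), fun hy => huj _ _ _ ((hu i x y).2 hy)⟩

theorem ss_isInverseMonoid : IsInverseMonoid (ssData k m) where
  mul_assoc a b c := ss_ext fun i x y => by simp only [mem_ss_mul]; grind
  one_mul a := ss_ext fun i x y => by simp only [mem_ss_mul, mem_ss_one]; grind
  mul_one a := ss_ext fun i x y => by simp only [mem_ss_mul, mem_ss_one]; grind
  zero_mul a := ss_ext fun i x y => by simp only [mem_ss_mul, not_mem_ss_zero]; grind
  mul_zero a := ss_ext fun i x y => by simp only [mem_ss_mul, not_mem_ss_zero]; grind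
  inv_law₁ a := ss_ext fun i x y => by
    rw [mem_ss_mul]
    simp only [mem_ss_mul_inv_self]
    constructor
    · rintro ⟨z, hz, rfl, -⟩
      exact hz
    · exact fun hy => ⟨y, hy, rfl, x, hy⟩
  inv_law₂ a := ss_ext fun i x y => by
    rw [mem_ss_mul]
    simp only [mem_ss_inv_mul_self, mem_ss_inv]
    constructor
    · rintro ⟨z, hz, rfl, -⟩
      exact hz
    · exact fun hy => ⟨y, hy, rfl, x, hy⟩
  inv_unique a b hab hba := ss_ext fun i x y => by
    rw [mem_ss_inv]
    constructor
    · intro hy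
      have hy' := hy
      rw [← hba] at hy'
      obtain ⟨u, hu, v⟩ := mem_ss_mul.1 hy'
      obtain ⟨w, hw, hw'⟩ := mem_ss_mul.1 v
      obtain rfl := ss_functional b hu hy
      obtain rfl := ss_injective b hw' hy
      exact hw
    · intro hy
      have hy' := hy
      rw [← hab] at hy'
      obtain ⟨u, hu, v⟩ := mem_ss_mul.1 hy'
      obtain ⟨w, hw, hw'⟩ := mem_ss_mul.1 v
      obtain rfl := ss_functional a hu hy
      obtain rfl := ss_injective a hw' hy
      exact hw

theorem ss_isBooleanInverseMonoid : IsBooleanInverseMonoid (ssData k m) where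
  invMon := ss_isInverseMonoid
  joins_exist _ _ h := (ss_exists_join h).imp fun _ => ss_isJoin_of_mem
  mul_join_left c a b j h := by
    rw [ss_isJoin_iff] at h ⊢
    intro i x y
    simp only [mem_ss_mul, h]
    grind
  mul_join_right c a b j h := by
    rw [ss_isJoin_iff] at h ⊢
    intro i x y
    simp only [mem_ss_mul, h]
    grind
  compl_exists e he := by
    refine ⟨ssIdem fun i x => ¬ x ∈ e i x, he, ssIdem_isIdem _, ss_ext fun i x y => ?_,
      ss_isJoin_of_mem fun i x y => ?_⟩
    · simp only [mem_ss_mul, mem_ssIdem, not_mem_ss_zero, iff_false]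
      rintro ⟨z, ⟨rfl, hx⟩, hy⟩
      obtain rfl := ss_isIdem_iff.1 he _ _ _ hy
      exact hx hy
    · rw [mem_ss_one, mem_ssIdem]
      constructor
      · rintro rfl
        by_cases h : x ∈ e i x
        · exact Or.inl h
        · exact Or.inr ⟨rfl, h⟩
      · rintro (hy | ⟨rfl, -⟩)
        · exact ss_isIdem_iff.1 he _ _ _ hy
        · rfl

theorem ss_hasMeets : HasMeets (ssData k m) := by
  intro a b
  refine ⟨fun i => pequivOfRel (fun x y => y ∈ a i x ∧ y ∈ b i x)
    (fun _ _ _ h h' => ss_functional a h.1 h'.1) (fun _ _ _ h h' => ss_injective a h.1 h'.1), ?_⟩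
  simp only [IsMeet, ss_nle_iff, mem_pequivOfRel]
  exact ⟨fun _ _ _ h => h.1, fun _ _ _ h => h.2,
    fun c ha hb i x y h => ⟨ha _ _ _ h, hb _ _ _ h⟩⟩

theorem ss_fundamental : Fundamental (ssData k m) := by
  intro s hs
  refine ss_isIdem_iff.2 fun i x y hy => ?_
  have h := hs _ (ssIdem_isIdem fun i' x' => (⟨i', x'⟩ : Σ i, Fin (m i)) = ⟨i, x⟩)
  have hmem : y ∈ (ssData k m).mul s
      (ssIdem fun i' x' => (⟨i', x'⟩ : Σ i, Fin (m i)) = ⟨i, x⟩) i x :=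
    mem_ss_mul.2 ⟨x, mem_ssIdem.2 ⟨rfl, rfl⟩, hy⟩
  rw [h] at hmem
  obtain ⟨z, -, hz⟩ := mem_ss_mul.1 hmem
  have hzx := (mem_ssIdem.1 hz).2
  have hzy := (mem_ssIdem.1 hz).1
  exact (eq_of_heq (Sigma.mk.inj hzx).2).symm.trans hzy

theorem ss_completelySemisimple : CompletelySemisimple (ssData k m) := by
  classical
  rintro _ _ - - ⟨a, rfl, rfl⟩ hle
  rw [ss_nle_iff] at hle
  simp only [mem_ss_mul_inv_self, mem_ss_inv_mul_self] at hle
  refine ss_ext fun i x y => ?_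
  rw [mem_ss_mul_inv_self, mem_ss_inv_mul_self]
  refine and_congr_right fun _ => ?_
  let dom : Finset (Fin (m i)) := Finset.univ.filter fun x => ∃ z, z ∈ a i x
  let ran : Finset (Fin (m i)) := Finset.univ.filter fun x => ∃ z, x ∈ a i z
  have hsub : ran ⊆ dom := fun x hx => by
    simp only [ran, dom, Finset.mem_filter, Finset.mem_univ, true_and] at hx ⊢
    exact (hle i x x ⟨rfl, hx⟩).2
  have hdom : ∀ x ∈ dom, ∃ z, z ∈ a i x := fun x hx => (Finset.mem_filter.1 hx).2
  have hcard : dom.card ≤ ran.card :=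
    Finset.card_le_card_of_injOn (fun x => (a i x).getD x)
      (fun x hx => by
        obtain ⟨z, hz⟩ := hdom x hx
        simp only [ran, Finset.coe_filter, Finset.mem_univ, true_and, Set.mem_ofPred_eq]
        exact ⟨x, by simp [Option.mem_def.1 hz]⟩)
      (fun x hx x' hx' h => by
        obtain ⟨z, hz⟩ := hdom x hx
        obtain ⟨z', hz'⟩ := hdom x' hx'
        simp only [Option.mem_def.1 hz, Option.mem_def.1 hz', Option.getD_some] at h
        subst h
        exact ss_injective a hz hz')
  have heq := Finset.eq_of_subset_of_card_le hsub hcard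
  simpa [ran, dom] using (Finset.ext_iff.1 heq x).symm

theorem exists_perm_extend_pequiv {α : Type} [Finite α] (f : PEquiv α α) :
    ∃ σ : Equiv.Perm α, ∀ x y, y ∈ f x → σ x = y := by
  choose g hg using fun x : {x // ∃ y, y ∈ f x} => x.2
  obtain ⟨σ, hσ⟩ := Equiv.Perm.exists_extending_pair (Subtype.val : {x // ∃ y, y ∈ f x} → α) g
    Subtype.val_injective
    (fun x x' h => Subtype.ext (PEquiv.inj f (hg x) (h ▸ hg x')))
  exact ⟨σ, fun x y h => (hσ ⟨x, y, h⟩).trans (Option.mem_unique (hg _) h)⟩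

theorem ss_factorizable : Factorizable (ssData k m) := by
  intro s
  choose σ hσ using fun i => exists_perm_extend_pequiv (s i)
  have hmem : ∀ i x y, y ∈ (σ i).toPEquiv x ↔ σ i x = y := fun i x y => by
    simp [Equiv.toPEquiv_apply]
  refine ⟨fun i => (σ i).toPEquiv, ss_ext fun i x y => ?_, ss_ext fun i x y => ?_,
    ss_nle_iff.2 fun i x y hy => (hmem i x y).2 (hσ i x y hy)⟩
  · rw [mem_ss_mul_inv_self, mem_ss_one]
    exact and_iff_left ⟨(σ i).symm x, (hmem _ _ _).2 ((σ i).apply_symm_apply x)⟩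
  · rw [mem_ss_inv_mul_self, mem_ss_one]
    exact and_iff_left ⟨σ i x, (hmem _ _ _).2 rfl⟩

theorem ss_isComplPair_mem {e f : ∀ i : Fin k, PEquiv (Fin (m i)) (Fin (m i))}
    (h : IsComplPair (ssData k m) e f) {i x y} : y ∈ f i x ↔ x = y ∧ ¬ x ∈ e i x := by
  obtain ⟨-, hf, h0, h1⟩ := h
  rw [ss_isIdem_iff] at hf
  constructor
  · intro hy
    obtain rfl := hf _ _ _ hy
    refine ⟨rfl, fun hx => not_mem_ss_zero (k := k) (m := m) (i := i) (x := x) (y := x) ?_⟩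
    rw [← h0]
    exact mem_ss_mul.2 ⟨x, hy, hx⟩
  · rintro ⟨rfl, hx⟩
    exact ((ss_isJoin_iff.1 h1 i x x).1 (mem_ss_one.2 rfl)).resolve_left hx

theorem ss_dPreservesCompl : DPreservesCompl (ssData k m) := by
  rintro _ _ e' f' ⟨a, rfl, rfl⟩ he hf
  obtain ⟨g, hg₁, hg₂, hag⟩ := ss_factorizable a
  rw [ss_nle_iff] at hag
  have hdom : ∀ i x, ∃ y, y ∈ g i x := fun i x => by
    have : x ∈ (ssData k m).one i x := mem_ss_one.2 rfl
    rw [← hg₂] at this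
    exact (mem_ss_inv_mul_self.1 this).2
  have hran : ∀ i x, ∃ y, x ∈ g i y := fun i x => by
    have : x ∈ (ssData k m).one i x := mem_ss_one.2 rfl
    rw [← hg₁] at this
    exact (mem_ss_mul_inv_self.1 this).2
  refine ⟨(ssData k m).mul g e', ss_ext fun i x y => ?_, ss_ext fun i x y => ?_⟩
  · rw [mem_ss_inv_mul_self, ss_isComplPair_mem he]
    refine and_congr_right fun _ => ?_
    simp only [mem_ss_mul, ss_isComplPair_mem he]
    constructor
    · rintro ⟨-, _, ⟨-, h⟩, -⟩
      exact h
    · intro h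
      obtain ⟨z, hz⟩ := hdom i x
      exact ⟨z, x, ⟨rfl, h⟩, hz⟩
  · rw [mem_ss_mul_inv_self, ss_isComplPair_mem hf]
    refine and_congr_right fun _ => ?_
    simp only [mem_ss_mul (a := g), ss_isComplPair_mem he, mem_ss_inv_mul_self,
      mem_ss_mul_inv_self, true_and]
    constructor
    · rintro ⟨z, _, ⟨rfl, h⟩, hz⟩ ⟨w, hw⟩
      obtain rfl := ss_injective g hz (hag _ _ _ hw)
      exact h ⟨x, hw⟩
    · intro h
      obtain ⟨z, hz⟩ := hran i x
      refine ⟨z, z, ⟨rfl, ?_⟩, hz⟩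
      rintro ⟨w, hw⟩
      obtain rfl := ss_functional g hz (hag _ _ _ hw)
      exact h ⟨z, hw⟩

end SemisimpleLevel

/-- `M` is exhausted by embedded semisimple inverse monoids: each of the maps `φ i` is an
injective morphism, and every element of `M` eventually lies in the image of `φ i`. -/
structure IsExhaustion (M : InvMonData T) {k : ℕ → ℕ} {m : ∀ i, Fin (k i) → ℕ}
    (φ : ∀ i, Level k m i → T) : Prop where
  morphism : ∀ i, IsMorphism (ssData (k i) (m i)) M (φ i)
  injective : ∀ i, Function.Injective (φ i)
  map_inv : ∀ i a, φ i ((ssData (k i) (m i)).inv a) = M.inv (φ i a)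
  eventually_mem : ∀ t, ∀ᶠ i in Filter.atTop, ∃ a, φ i a = t

theorem IsAF.exists_isExhaustion {M : InvMonData T} (h : IsAF M) :
    ∃ (k : ℕ → ℕ) (m : ∀ i, Fin (k i) → ℕ) (φ : ∀ i, Level k m i → T), IsExhaustion M φ := by
  obtain ⟨k, m, τ, φ, -, -, hφ, hinj, hinv, hτ, hex⟩ := h
  refine ⟨k, m, φ, hφ, hinj, hinv, fun t => ?_⟩
  obtain ⟨i, a, rfl⟩ := hex t
  refine Filter.eventually_atTop.2 ⟨i, fun j hij => ?_⟩
  induction j, hij using Nat.le_induction with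
  | base => exact ⟨a, rfl⟩
  | succ j _ ih =>
    obtain ⟨b, hb⟩ := ih
    exact ⟨τ j b, (hτ j b).trans hb⟩

namespace IsExhaustion

variable {M : InvMonData T} {k : ℕ → ℕ} {m : ∀ i, Fin (k i) → ℕ} {φ : ∀ i, Level k m i → T}

theorem map_one (H : IsExhaustion M φ) (i : ℕ) : φ i (ssData (k i) (m i)).one = M.one :=
  (H.morphism i).1

theorem map_zero (H : IsExhaustion M φ) (i : ℕ) : φ i (ssData (k i) (m i)).zero = M.zero :=
  (H.morphism i).2.1

theorem map_mul (H : IsExhaustion M φ) (i : ℕ) (a b : Level k m i) :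
    φ i ((ssData (k i) (m i)).mul a b) = M.mul (φ i a) (φ i b) :=
  (H.morphism i).2.2.1 a b

theorem isIdem_iff (H : IsExhaustion M φ) {i : ℕ} {e : Level k m i} :
    IsIdem M (φ i e) ↔ IsIdem (ssData (k i) (m i)) e := by
  rw [IsIdem, IsIdem, ← H.map_mul, (H.injective i).eq_iff]

theorem compatible_iff (H : IsExhaustion M φ) {i : ℕ} {a b : Level k m i} :
    Compatible M (φ i a) (φ i b) ↔ Compatible (ssData (k i) (m i)) a b := by
  rw [Compatible, Compatible, ← H.map_inv, ← H.map_inv, ← H.map_mul, ← H.map_mul,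
    H.isIdem_iff, H.isIdem_iff]

theorem nle_iff (H : IsExhaustion M φ) {i : ℕ} {a b : Level k m i} :
    nle M (φ i a) (φ i b) ↔ nle (ssData (k i) (m i)) a b := by
  constructor
  · rintro ⟨e, he, hab⟩
    rw [ss_nle_iff_eq]
    apply H.injective i
    rw [H.map_mul, H.map_mul, H.map_inv]
    obtain ⟨j, ⟨a', ha'⟩, ⟨b', hb'⟩, ⟨e', rfl⟩⟩ := ((H.eventually_mem (φ i a)).and
      ((H.eventually_mem (φ i b)).and (H.eventually_mem e))).exists
    rw [← ha', ← hb', ← H.map_mul] at hab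
    rw [← ha', ← hb', ← H.map_inv, ← H.map_mul, ← H.map_mul,
      ← ss_nle_iff_eq.1 ⟨e', H.isIdem_iff.1 he, H.injective j hab⟩]
  · rintro ⟨e, he, rfl⟩
    exact ⟨φ i e, H.isIdem_iff.2 he, H.map_mul i b e⟩

theorem isJoin_iff (H : IsExhaustion M φ) {i : ℕ} {a b j : Level k m i} :
    IsJoin M (φ i a) (φ i b) (φ i j) ↔ IsJoin (ssData (k i) (m i)) a b j := by
  constructor
  · rintro ⟨ha, hb, hc⟩
    exact ⟨H.nle_iff.1 ha, H.nle_iff.1 hb,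
      fun c hac hbc => H.nle_iff.1 (hc _ (H.nle_iff.2 hac) (H.nle_iff.2 hbc))⟩
  · exact fun h => (H.morphism i).2.2.2.1 _ _ _ (ss_compatible_of_nle h.1 h.2.1) h

theorem isComplPair_iff (H : IsExhaustion M φ) {i : ℕ} {e f : Level k m i} :
    IsComplPair M (φ i e) (φ i f) ↔ IsComplPair (ssData (k i) (m i)) e f := by
  rw [IsComplPair, IsComplPair, H.isIdem_iff, H.isIdem_iff, ← H.map_one i, H.isJoin_iff,
    ← H.map_mul, ← H.map_zero i, (H.injective i).eq_iff]

theorem dRel_map (H : IsExhaustion M φ) {i : ℕ} {e f : Level k m i}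
    (h : DRel (ssData (k i) (m i)) e f) : DRel M (φ i e) (φ i f) := by
  obtain ⟨a, rfl, rfl⟩ := h
  exact ⟨φ i a, by rw [H.map_mul, H.map_inv], by rw [H.map_mul, H.map_inv]⟩

theorem isInverseMonoid (H : IsExhaustion M φ) : IsInverseMonoid M where
  mul_assoc a b c := by
    obtain ⟨i, ⟨a, rfl⟩, ⟨b, rfl⟩, ⟨c, rfl⟩⟩ := ((H.eventually_mem a).and
      ((H.eventually_mem b).and (H.eventually_mem c))).exists
    simp only [← H.map_mul, ss_isInverseMonoid.mul_assoc]
  one_mul a := by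
    obtain ⟨i, ⟨a, rfl⟩⟩ := (H.eventually_mem a).exists
    rw [← H.map_one i, ← H.map_mul, ss_isInverseMonoid.one_mul]
  mul_one a := by
    obtain ⟨i, ⟨a, rfl⟩⟩ := (H.eventually_mem a).exists
    rw [← H.map_one i, ← H.map_mul, ss_isInverseMonoid.mul_one]
  zero_mul a := by
    obtain ⟨i, ⟨a, rfl⟩⟩ := (H.eventually_mem a).exists
    rw [← H.map_zero i, ← H.map_mul, ss_isInverseMonoid.zero_mul]
  mul_zero a := by
    obtain ⟨i, ⟨a, rfl⟩⟩ := (H.eventually_mem a).exists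
    rw [← H.map_zero i, ← H.map_mul, ss_isInverseMonoid.mul_zero]
  inv_law₁ a := by
    obtain ⟨i, ⟨a, rfl⟩⟩ := (H.eventually_mem a).exists
    rw [← H.map_inv, ← H.map_mul, ← H.map_mul, ss_isInverseMonoid.inv_law₁]
  inv_law₂ a := by
    obtain ⟨i, ⟨a, rfl⟩⟩ := (H.eventually_mem a).exists
    rw [← H.map_inv, ← H.map_mul, ← H.map_mul, ss_isInverseMonoid.inv_law₂]
  inv_unique a b hab hba := by
    obtain ⟨i, ⟨a, rfl⟩, ⟨b, rfl⟩⟩ := ((H.eventually_mem a).and (H.eventually_mem b)).exists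
    rw [← H.map_mul, ← H.map_mul] at hab hba
    rw [← H.map_inv, ← ss_isInverseMonoid.inv_unique a b (H.injective i hab) (H.injective i hba)]

theorem isBooleanInverseMonoid (H : IsExhaustion M φ) : IsBooleanInverseMonoid M where
  invMon := H.isInverseMonoid
  joins_exist a b h := by
    obtain ⟨i, ⟨a, rfl⟩, ⟨b, rfl⟩⟩ := ((H.eventually_mem a).and (H.eventually_mem b)).exists
    obtain ⟨j, hj⟩ := ss_isBooleanInverseMonoid.joins_exist a b (H.compatible_iff.1 h)
    exact ⟨φ i j, H.isJoin_iff.2 hj⟩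
  mul_join_left c a b j h := by
    obtain ⟨i, ⟨⟨c, rfl⟩, ⟨a, rfl⟩⟩, ⟨b, rfl⟩, ⟨j, rfl⟩⟩ :=
      (((H.eventually_mem c).and (H.eventually_mem a)).and
        ((H.eventually_mem b).and (H.eventually_mem j))).exists
    simp only [← H.map_mul, H.isJoin_iff] at h ⊢
    exact ss_isBooleanInverseMonoid.mul_join_left c a b j h
  mul_join_right c a b j h := by
    obtain ⟨i, ⟨⟨c, rfl⟩, ⟨a, rfl⟩⟩, ⟨b, rfl⟩, ⟨j, rfl⟩⟩ :=
      (((H.eventually_mem c).and (H.eventually_mem a)).and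
        ((H.eventually_mem b).and (H.eventually_mem j))).exists
    simp only [← H.map_mul, H.isJoin_iff] at h ⊢
    exact ss_isBooleanInverseMonoid.mul_join_right c a b j h
  compl_exists e he := by
    obtain ⟨i, ⟨e, rfl⟩⟩ := (H.eventually_mem e).exists
    obtain ⟨f, hf⟩ := ss_isBooleanInverseMonoid.compl_exists e (H.isIdem_iff.1 he)
    exact ⟨φ i f, H.isComplPair_iff.2 hf⟩

theorem hasMeets (H : IsExhaustion M φ) : HasMeets M := by
  intro a b
  obtain ⟨i, ⟨a, rfl⟩, ⟨b, rfl⟩⟩ := ((H.eventually_mem a).and (H.eventually_mem b)).exists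
  obtain ⟨c, hc⟩ := ss_hasMeets a b
  exact ⟨φ i c, (H.morphism i).2.2.2.2 _ _ _ hc⟩

theorem fundamental (H : IsExhaustion M φ) : Fundamental M := by
  intro s hs
  obtain ⟨i, ⟨s, rfl⟩⟩ := (H.eventually_mem s).exists
  refine H.isIdem_iff.2 (ss_fundamental s fun e he => H.injective i ?_)
  rw [H.map_mul, H.map_mul, hs _ (H.isIdem_iff.2 he)]

theorem completelySemisimple (H : IsExhaustion M φ) : CompletelySemisimple M := by
  rintro _ _ he hf ⟨a, rfl, rfl⟩ hle
  obtain ⟨i, ⟨a, rfl⟩⟩ := (H.eventually_mem a).exists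
  simp only [← H.map_inv, ← H.map_mul, H.isIdem_iff, H.nle_iff] at he hf hle ⊢
  rw [ss_completelySemisimple _ _ he hf ⟨a, rfl, rfl⟩ hle]

theorem factorizable (H : IsExhaustion M φ) : Factorizable M := by
  intro s
  obtain ⟨i, ⟨s, rfl⟩⟩ := (H.eventually_mem s).exists
  obtain ⟨g, hg₁, hg₂, hs⟩ := ss_factorizable s
  exact ⟨φ i g, by rw [← H.map_inv, ← H.map_mul, hg₁, H.map_one],
    by rw [← H.map_inv, ← H.map_mul, hg₂, H.map_one], H.nle_iff.2 hs⟩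

theorem dPreservesCompl (H : IsExhaustion M φ) : DPreservesCompl M := by
  rintro _ _ e' f' ⟨a, rfl, rfl⟩ he hf
  obtain ⟨i, ⟨a, rfl⟩, ⟨e', rfl⟩, ⟨f', rfl⟩⟩ := ((H.eventually_mem a).and
    ((H.eventually_mem e').and (H.eventually_mem f'))).exists
  simp only [← H.map_inv, ← H.map_mul, H.isComplPair_iff] at he hf
  exact H.dRel_map (ss_dPreservesCompl _ _ _ _ ⟨a, rfl, rfl⟩ he hf)

end IsExhaustion

/-- Every AF inverse monoid is a fundamental Boolean inverse `∧`-monoid which is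
completely semisimple, factorizable, and in which `D` preserves complementation;
that is, AF inverse monoids are fundamental Foulis `∧`-monoids. -/
theorem af_inverse_monoids_are_foulis {T : Type} (M : InvMonData T) (hAF : IsAF M) :
    IsBooleanInverseMonoid M ∧ HasMeets M ∧ Fundamental M ∧
      CompletelySemisimple M ∧ Factorizable M ∧ DPreservesCompl M := by
  obtain ⟨k, m, φ, H⟩ := hAF.exists_isExhaustion
  exact ⟨H.isBooleanInverseMonoid, H.hasMeets, H.fundamental, H.completelySemisimple,
    H.factorizable, H.dPreservesCompl⟩

end Coordinatization
end

section
/- Let S be a Boolean inverse monoid in which the relation D preserves complementation and in which e D 1 implies e = 1 for every idempotent e. Then S is completely semisimple: for idempotents e, f, if e D f and f ≤ e then e = f. -/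
namespace Coordinatization

namespace IsInverseMonoid

variable {S : Type} {M : InvMonData S}

theorem inv_eq_self_of_isIdem (h : IsInverseMonoid M) {e : S} (he : IsIdem M e) : M.inv e = e := by
  have he' : M.mul e e = e := he
  exact (h.inv_unique e e (by rw [he', he']) (by rw [he', he'])).symm

theorem inv_inv (h : IsInverseMonoid M) (a : S) : M.inv (M.inv a) = a :=
  (h.inv_unique (M.inv a) a (h.inv_law₂ a) (h.inv_law₁ a)).symm

theorem isIdem_inv_mul (h : IsInverseMonoid M) (a : S) : IsIdem M (M.mul (M.inv a) a) := by
  rw [IsIdem, ← h.mul_assoc, h.inv_law₂]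

theorem isIdem_mul (h : IsInverseMonoid M) {e f : S} (he : IsIdem M e) (hf : IsIdem M f) :
    IsIdem M (M.mul e f) := by
  have he' : M.mul e e = e := he
  have hf' : M.mul f f = f := hf
  have assoc := h.mul_assoc
  have h₁ := h.inv_law₁ (M.mul e f)
  have h₂ := h.inv_law₂ (M.mul e f)
  have h_inv := h.inv_inv (M.mul e f)
  have h_unique := h.inv_unique (M.mul e f)
  generalize M.inv (M.mul e f) = x at *
  have he₂ : ∀ z, M.mul e (M.mul e z) = M.mul e z := fun z => by rw [← assoc, he']
  have hf₂ : ∀ z, M.mul f (M.mul f z) = M.mul f z := fun z => by rw [← assoc, hf']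
  have h₂e : ∀ z, M.mul x (M.mul e (M.mul f (M.mul x z))) = M.mul x z := fun z => by
    simpa only [assoc] using congrArg (M.mul · z) h₂
  have hx : M.mul (M.mul f x) e = x :=
    h_unique _ (by simpa only [assoc, he₂, hf₂] using h₁)
      (by simp only [assoc, he₂, hf₂, h₂e])
  have x_idem : IsIdem M x := by
    rw [IsIdem, ← hx]
    simp only [assoc, h₂e]
  rw [← h_inv, h.inv_eq_self_of_isIdem x_idem]
  exact x_idem

theorem isIdem_mul_comm (h : IsInverseMonoid M) {e f : S} (he : IsIdem M e) (hf : IsIdem M f) :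
    M.mul e f = M.mul f e := by
  have he' : M.mul e e = e := he
  have hf' : M.mul f f = f := hf
  have hef : M.mul (M.mul e f) (M.mul e f) = M.mul e f := h.isIdem_mul he hf
  have hfe : M.mul (M.mul f e) (M.mul f e) = M.mul f e := h.isIdem_mul hf he
  have assoc := h.mul_assoc
  have he₂ : ∀ z, M.mul e (M.mul e z) = M.mul e z := fun z => by rw [← assoc, he']
  have hf₂ : ∀ z, M.mul f (M.mul f z) = M.mul f z := fun z => by rw [← assoc, hf']
  rw [h.inv_unique (M.mul e f) (M.mul f e)
    (by simpa only [assoc, he₂, hf₂] using hef) (by simpa only [assoc, he₂, hf₂] using hfe),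
    h.inv_eq_self_of_isIdem (h.isIdem_mul he hf)]

/-- The domain idempotent of an element is a right identity for everything below it. -/
theorem mul_inv_mul_of_nle (h : IsInverseMonoid M) {a b : S} (hab : nle M a b) :
    M.mul a (M.mul (M.inv b) b) = a := by
  obtain ⟨x, hx, rfl⟩ := hab
  rw [h.mul_assoc, h.isIdem_mul_comm hx (h.isIdem_inv_mul b), ← h.mul_assoc, ← h.mul_assoc,
    h.inv_law₁]

theorem nle_of_mul_eq (h : IsInverseMonoid M) {e f : S} (he : IsIdem M e)
    (hf : IsIdem M f) (hef : M.mul e f = e) :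
    nle M e f :=
  ⟨e, he, by rw [← h.isIdem_mul_comm he hf, hef]⟩

/-- An idempotent above the identity is the identity. -/
theorem eq_one_of_one_nle (h : IsInverseMonoid M) {e : S} (he : IsIdem M e)
    (hle : nle M M.one e) : e = M.one := by
  have he' : M.mul e e = e := he
  obtain ⟨g, -, hg⟩ := hle
  calc e = M.mul e (M.mul e g) := by rw [← hg, h.mul_one]
    _ = M.one := by rw [← h.mul_assoc, he', ← hg]

end IsInverseMonoid

/-- A Boolean inverse monoid in which `D` preserves complementation and in which
`e D 1` implies `e = 1` is completely semisimple. -/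
theorem completely_semisimple_of_dpc {S : Type} (M : InvMonData S)
    (hB : IsBooleanInverseMonoid M) (hD : DPreservesCompl M)
    (hone : ∀ e, IsIdem M e → DRel M e M.one → e = M.one) :
    CompletelySemisimple M := by
  rintro e f he hf ⟨a, hae, haf⟩ ⟨g, hg, hfg⟩
  have h := hB.invMon
  have he' : M.mul e e = e := he
  have hef : M.mul e f = f := by rw [hfg, ← h.mul_assoc, he']
  have hfe : M.mul f e = f := by rw [h.isIdem_mul_comm hf he, hef]
  have a_e : M.mul a e = a := by rw [← hae, ← h.mul_assoc, h.inv_law₁]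
  have f_a : M.mul f a = a := by rw [← haf, h.inv_law₁]
  have inv_f : M.mul (M.inv a) f = M.inv a := by rw [← haf, ← h.mul_assoc, h.inv_law₂]
  obtain ⟨c, -, hc, hec, hjoin⟩ := hB.compl_exists e he
  have zero_idem : IsIdem M M.zero := h.zero_mul _
  have a_c : M.mul a c = M.zero := by rw [← a_e, h.mul_assoc, hec, h.mul_zero]
  have inv_c : M.mul (M.inv a) c = M.zero := by
    rw [← inv_f, ← hfe, h.mul_assoc, h.mul_assoc, hec, h.mul_zero, h.mul_zero]
  -- Extend `a` by the identity on the complement of `e`.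
  obtain ⟨b, hb⟩ := hB.joins_exist a c
    ⟨by rwa [inv_c], by rwa [h.inv_eq_self_of_isIdem hc, a_c]⟩
  have b_idem := h.isIdem_inv_mul b
  have inv_b : M.mul (M.inv b) b = M.one := by
    refine h.eq_one_of_one_nle b_idem (hjoin.2.2 _ ?_ ?_)
    · refine h.nle_of_mul_eq he b_idem ?_
      rw [← hae, h.mul_assoc, h.mul_inv_mul_of_nle hb.1]
    · exact h.nle_of_mul_eq hc b_idem (h.mul_inv_mul_of_nle hb.2.1)
  have b_inv : M.mul b (M.inv b) = M.one := by
    refine hone _ ?_ ⟨M.inv b, by rw [h.inv_inv], by rw [h.inv_inv, inv_b]⟩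
    rw [IsIdem, ← h.mul_assoc, h.inv_law₁]
  have e_a : M.mul e a = a := by rw [← f_a, ← h.mul_assoc, hef]
  obtain ⟨x, -, hx⟩ := (hB.mul_join_left e a c b hb).2.2 a
    ⟨M.one, h.one_mul _, by rw [e_a, h.mul_one]⟩ ⟨M.zero, zero_idem, by rw [hec, h.mul_zero]⟩
  have f_e_b : M.mul f (M.mul e b) = M.mul e b := by rw [hx, ← h.mul_assoc, f_a]
  calc e = M.mul (M.mul e b) (M.inv b) := by rw [h.mul_assoc, b_inv, h.mul_one]
    _ = M.mul (M.mul f (M.mul e b)) (M.inv b) := by rw [f_e_b]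
    _ = f := by rw [h.mul_assoc, h.mul_assoc, b_inv, h.mul_one, hfe]

end Coordinatization
end
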